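/- Let n be an odd natural number with n ≥ 3 and take t = 0 in ZMod n. Then for every odd natural number k with 3 ≤ k ≤ n and every multiset μ of positive natural numbers with k + 2 · μ.sum = n, there exists a series s : Fin n ≃ ZMod n with s 0 = 0 such that the full cycle type of the proliferating permutation of s under retrograde inversion with transposition 0 equals k ::ₘ (μ + μ). -/

import Mathlib

/-- The full cycle type of a permutation: the multiset of the sizes of all its orbits,
with fixed points counted as orbits of size 1. -/
def fullCycleType {α : Type*} [Fintype α] [DecidableEq α] (σ : Equiv.Perm α) : Multiset ℕ :=
  σ.cycleType + Multiset.replicate (Finset.univ.filter fun x => σ x = x).card 1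

/-- The proliferating permutation of a series `s` under retrograde inversion with
transposition `t`: `x ↦ t - s (rev (s.symm x))`. -/
def ppRI {n : ℕ} [NeZero n] (t : ZMod n) (s : Fin n ≃ ZMod n) : Equiv.Perm (ZMod n) :=
  (s.symm.trans (Fin.revPerm.trans s)).trans (Equiv.subLeft t)

open Equiv Equiv.Perm

theorem card_fixed_permCongr {α β : Type*} [Fintype α] [DecidableEq α] [Fintype β]
    [DecidableEq β] (e : α ≃ β) (σ : Perm α) :
    (Finset.univ.filter fun x => e.permCongr σ x = x).card =
      (Finset.univ.filter fun x => σ x = x).card := by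
  refine (Finset.card_equiv e fun x => ?_).symm
  rw [Finset.mem_filter, Finset.mem_filter]
  simp

theorem fullCycleType_permCongr {α β : Type*} [Fintype α] [DecidableEq α] [Fintype β]
    [DecidableEq β] (e : α ≃ β) (σ : Perm α) :
    fullCycleType (e.permCongr σ) = fullCycleType σ := by
  have h : e.permCongr σ =
      σ.extendDomain (e.trans (Equiv.subtypeUnivEquiv (fun _ => trivial)).symm :
        α ≃ {_b : β // True}) := by
    ext b
    rw [Perm.extendDomain_apply_subtype _ _ trivial]
    rfl
  have hc : (e.permCongr σ).cycleType = σ.cycleType := by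
    rw [h, cycleType_extendDomain]
  unfold fullCycleType
  rw [hc, card_fixed_permCongr]

theorem cycleType_sumCongr {α β : Type*} [Fintype α] [DecidableEq α] [Fintype β]
    [DecidableEq β] (σ : Perm α) (τ : Perm β) :
    (Perm.sumCongr σ τ).cycleType = σ.cycleType + τ.cycleType := by
  classical
  have hl : Perm.sumCongr σ (1 : Perm β) =
      σ.extendDomain (Equiv.ofInjective (Sum.inl : α → α ⊕ β) Sum.inl_injective) := by
    ext x
    rcases x with x | x
    · have := Perm.extendDomain_apply_image σ
        (Equiv.ofInjective (Sum.inl : α → α ⊕ β) Sum.inl_injective) x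
      simpa using this.symm
    · rw [Perm.extendDomain_apply_not_subtype _ _ (by simp)]
      simp
  have hr : Perm.sumCongr (1 : Perm α) τ =
      τ.extendDomain (Equiv.ofInjective (Sum.inr : β → α ⊕ β) Sum.inr_injective) := by
    ext x
    rcases x with x | x
    · rw [Perm.extendDomain_apply_not_subtype _ _ (by simp)]
      simp
    · have := Perm.extendDomain_apply_image τ
        (Equiv.ofInjective (Sum.inr : β → α ⊕ β) Sum.inr_injective) x
      simpa using this.symm
  have hd : Perm.Disjoint (Perm.sumCongr σ (1 : Perm β)) (Perm.sumCongr (1 : Perm α) τ) := by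
    rintro (x | x) <;> simp
  have hm : Perm.sumCongr σ τ = Perm.sumCongr σ (1 : Perm β) * Perm.sumCongr (1 : Perm α) τ := by
    simp [sumCongr_mul]
  rw [hm, hd.cycleType_mul, hl, hr, cycleType_extendDomain, cycleType_extendDomain]

theorem card_fixed_sumCongr {α β : Type*} [Fintype α] [DecidableEq α] [Fintype β]
    [DecidableEq β] (σ : Perm α) (τ : Perm β) :
    (Finset.univ.filter fun x => Perm.sumCongr σ τ x = x).card =
      (Finset.univ.filter fun x => σ x = x).card + (Finset.univ.filter fun x => τ x = x).card := by
  simp only [Finset.card_filter, Fintype.sum_sum_type]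
  simp

theorem fullCycleType_sumCongr {α β : Type*} [Fintype α] [DecidableEq α] [Fintype β]
    [DecidableEq β] (σ : Perm α) (τ : Perm β) :
    fullCycleType (Perm.sumCongr σ τ) = fullCycleType σ + fullCycleType τ := by
  unfold fullCycleType
  rw [cycleType_sumCongr, card_fixed_sumCongr, Multiset.replicate_add]
  abel

theorem sum_fullCycleType {α : Type*} [Fintype α] [DecidableEq α] (σ : Perm α) :
    (fullCycleType σ).sum = Fintype.card α := by
  have h : (Finset.univ.filter fun x => σ x = x).card + σ.support.card = Fintype.card α :=
    Finset.card_filter_add_card_filter_not _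
  rw [fullCycleType, Multiset.sum_add, sum_cycleType, Multiset.sum_replicate, smul_eq_mul,
    mul_one, add_comm, h]

theorem fullCycleType_addRight_one (c : ℕ) [NeZero c] :
    fullCycleType (Equiv.addRight (1 : ZMod c)) = {c} := by
  obtain _ | _ | c := c
  · exact absurd rfl (NeZero.ne 0)
  · have h : Equiv.addRight (1 : ZMod (0 + 1)) = 1 := Subsingleton.elim (α := Perm (Fin 1)) _ _
    rw [h]
    simp [fullCycleType]
  · have h : Equiv.addRight (1 : ZMod (c + 2)) = finRotate (c + 2) := by
      refine Equiv.ext fun x => ?_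
      exact (finRotate_apply (n := c + 2) x).symm
    have h0 : (Finset.univ.filter fun x : ZMod (c + 2) =>
        Equiv.addRight (1 : ZMod (c + 2)) x = x) = ∅ := by
      have : Fact (1 < c + 2) := ⟨by omega⟩
      simp
    unfold fullCycleType
    rw [h0, h]
    exact (add_zero _).trans cycleType_finRotate

/-- Involutions with equally many fixed points are conjugate. -/
theorem exists_equiv_conj_of_involutive {α β : Type*} [Fintype α] [DecidableEq α] [Fintype β]
    [DecidableEq β] {A : Perm α} {B : Perm β} (hA : A ^ 2 = 1) (hB : B ^ 2 = 1)
    (hfix : (Finset.univ.filter fun x => A x = x).card =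
      (Finset.univ.filter fun x => B x = x).card)
    (hcard : Fintype.card α = Fintype.card β) :
    ∃ e : α ≃ β, ∀ x, e (A x) = B (e x) := by
  have e₀ := Fintype.equivOfCardEq hcard
  have hsum : (fullCycleType A).sum = (fullCycleType B).sum := by
    rw [sum_fullCycleType, sum_fullCycleType, hcard]
  have hfull : fullCycleType A = fullCycleType B := by
    unfold fullCycleType at hsum ⊢
    rw [cycleType_of_pow_prime_eq_one hA, cycleType_of_pow_prime_eq_one hB, hfix] at hsum ⊢
    simp only [Multiset.sum_add, Multiset.sum_replicate, smul_eq_mul] at hsum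
    congr 2
    omega
  rw [← fullCycleType_permCongr e₀ A] at hfull
  have hfix' : (Finset.univ.filter fun x => e₀.permCongr A x = x).card =
      (Finset.univ.filter fun x => B x = x).card := by
    rw [card_fixed_permCongr, hfix]
  have hct : (e₀.permCongr A).cycleType = B.cycleType := by
    unfold fullCycleType at hfull
    rw [hfix'] at hfull
    exact add_right_cancel hfull
  obtain ⟨g, hg⟩ := isConj_iff.mp (isConj_iff_cycleType_eq.mpr hct)
  refine ⟨e₀.trans g, fun x => ?_⟩
  rw [← hg]
  simp

/-- Involutions with equally many fixed points are conjugate by a bijection taking any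
prescribed moved point to any prescribed moved point. -/
theorem exists_equiv_conj_of_involutive_apply_eq {α β : Type*} [Fintype α] [DecidableEq α]
    [Fintype β] [DecidableEq β] {A : Perm α} {B : Perm β} (hA : A ^ 2 = 1) (hB : B ^ 2 = 1)
    (hfix : (Finset.univ.filter fun x => A x = x).card =
      (Finset.univ.filter fun x => B x = x).card)
    (hcard : Fintype.card α = Fintype.card β) {a : α} {b : β} (ha : A a ≠ a) (hb : B b ≠ b) :
    ∃ e : α ≃ β, (∀ x, e (A x) = B (e x)) ∧ e a = b := by
  obtain ⟨e, he⟩ := exists_equiv_conj_of_involutive hA hB hfix hcard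
  have hBB : ∀ x, B (B x) = x := fun x => by
    simpa [pow_two] using congrArg (fun f : Perm β => f x) hB
  have hc : B (e a) ≠ e a := by
    rw [← he]
    exact fun h => ha (e.injective h)
  by_cases h : e a = B b
  · exact ⟨e.trans B, fun x => by simp [he], by simp [h, hBB]⟩
  · refine ⟨e.trans (swap (B b) (B (e a)) * swap b (e a)), fun x => ?_, ?_⟩
    · have hinj : ∀ y z, B y = B z → y = z := fun y z => fun h => B.injective h
      simp only [Equiv.trans_apply, Perm.mul_apply, he, swap_apply_def]
      grind
    · simp only [Equiv.trans_apply, Perm.mul_apply, swap_apply_def]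
      grind

/-- Every multiset `μ + μ` of positive naturals is the full cycle type of a product of two
fixed-point-free involutions. -/
theorem exists_fixedPointFree_involutions_mul (μ : Multiset ℕ) (hμ : ∀ c ∈ μ, 0 < c) :
    ∃ (m : ℕ) (A B : Perm (Fin m)), A ^ 2 = 1 ∧ B ^ 2 = 1 ∧ (∀ x, A x ≠ x) ∧ (∀ x, B x ≠ x) ∧
      fullCycleType (A * B) = μ + μ := by
  induction μ using Multiset.induction with
  | empty => exact ⟨0, 1, 1, by simp, by simp, fun x => x.elim0, fun x => x.elim0, by decide⟩
  | cons c μ ih =>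
    obtain ⟨m, A, B, hA, hB, hA', hB', hAB⟩ := ih fun d hd => hμ d (Multiset.mem_cons_of_mem hd)
    have : NeZero c := ⟨(hμ c (Multiset.mem_cons_self c μ)).ne'⟩
    let P : Perm (ZMod c ⊕ ZMod c) :=
      (Perm.sumCongr (Equiv.neg (ZMod c)) (Equiv.neg (ZMod c))).trans (Equiv.sumComm _ _)
    let Q : Perm (ZMod c ⊕ ZMod c) :=
      (Perm.sumCongr (Equiv.subLeft (-1 : ZMod c)) (Equiv.subLeft (-1 : ZMod c))).trans
        (Equiv.sumComm _ _)
    have hP : P ^ 2 = 1 := by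
      ext x
      rcases x with x | x <;> simp [P, pow_two]
    have hQ : Q ^ 2 = 1 := by
      ext x
      rcases x with x | x <;> simp [Q, pow_two]
    have hP' : ∀ x, P x ≠ x := by rintro (x | x) <;> simp [P]
    have hQ' : ∀ x, Q x ≠ x := by rintro (x | x) <;> simp [Q]
    have hPQ : P * Q = Perm.sumCongr (Equiv.addRight (1 : ZMod c)) (Equiv.addRight (1 : ZMod c)) := by
      ext x
      rcases x with x | x <;> simp [P, Q]
    let e := Fintype.equivFin ((ZMod c ⊕ ZMod c) ⊕ Fin m)
    have hsq : ∀ σ : Perm ((ZMod c ⊕ ZMod c) ⊕ Fin m), σ ^ 2 = 1 → (e.permCongr σ) ^ 2 = 1 := by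
      intro σ hσ
      ext x
      have := congrArg (fun f : Perm _ => f (e.symm x)) hσ
      simp only [pow_two, Perm.mul_apply, Perm.one_apply] at this
      simp [pow_two, this]
    have hne : ∀ σ : Perm ((ZMod c ⊕ ZMod c) ⊕ Fin m), (∀ x, σ x ≠ x) →
        ∀ x, e.permCongr σ x ≠ x := by
      intro σ hσ x h
      apply hσ (e.symm x)
      rw [Equiv.eq_symm_apply]
      simpa using h
    refine ⟨_, e.permCongr (Perm.sumCongr P A), e.permCongr (Perm.sumCongr Q B), hsq _ ?_, hsq _ ?_,
      hne _ ?_, hne _ ?_, ?_⟩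
    · rw [pow_two, sumCongr_mul, ← pow_two, ← pow_two, hP, hA, sumCongr_one]
    · rw [pow_two, sumCongr_mul, ← pow_two, ← pow_two, hQ, hB, sumCongr_one]
    · rintro (x | x)
      · simpa using hP' x
      · simpa using hA' x
    · rintro (x | x)
      · simpa using hQ' x
      · simpa using hB' x
    · have hmul : e.permCongr (Perm.sumCongr P A) * e.permCongr (Perm.sumCongr Q B) =
          e.permCongr (Perm.sumCongr (P * Q) (A * B)) := by
        ext x
        simp [← sumCongr_mul]
      rw [hmul, fullCycleType_permCongr, fullCycleType_sumCongr, hPQ, fullCycleType_sumCongr,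
        fullCycleType_addRight_one, hAB]
      simp only [← Multiset.singleton_add]
      abel

theorem card_fixed_subLeft {n : ℕ} [NeZero n] (hn : Odd n) (a : ZMod n) :
    (Finset.univ.filter fun x => Equiv.subLeft a x = x).card = 1 := by
  obtain ⟨m, hm⟩ := hn
  have h2 : (2 : ZMod n) * (-m) = 1 := by
    have : ((2 * m + 1 : ℕ) : ZMod n) = 0 := by rw [← hm, ZMod.natCast_self]
    push_cast at this
    linear_combination -this
  rw [Finset.card_eq_one]
  refine ⟨-m * a, ?_⟩
  ext x
  simp only [Finset.mem_filter, Finset.mem_univ, true_and, Finset.mem_singleton,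
    Equiv.subLeft_apply]
  constructor
  · intro h
    linear_combination m * h - x * h2
  · intro h
    subst h
    linear_combination -a * h2

theorem card_fixed_revPerm {n : ℕ} (hn : Odd n) :
    (Finset.univ.filter fun i : Fin n => Fin.revPerm i = i).card = 1 := by
  obtain ⟨m, hm⟩ := hn
  rw [Finset.card_eq_one]
  refine ⟨⟨m, by omega⟩, ?_⟩
  ext i
  simp only [Finset.mem_filter, Finset.mem_univ, true_and, Finset.mem_singleton,
    Fin.revPerm_apply, Fin.ext_iff, Fin.val_rev]
  omega

theorem subLeft_sq {G : Type*} [AddCommGroup G] (a : G) :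
    (Equiv.subLeft a : Perm G) ^ 2 = 1 := by
  ext x
  simp [pow_two]

/-- for `n` odd, `n ≥ 3` and `t = 0`, every structure `k ::ₘ (μ + μ)` with
`k` odd, `3 ≤ k ≤ n`, `μ` a multiset of positive naturals and `k + 2 * μ.sum = n`, is
realized as the full cycle type of the RI proliferating permutation of some series. -/
theorem stmt_10 (n : ℕ) [NeZero n] (hn : Odd n) (hn3 : 3 ≤ n)
    (k : ℕ) (hk : Odd k) (hk3 : 3 ≤ k) (hkn : k ≤ n)
    (μ : Multiset ℕ) (hμ : ∀ c ∈ μ, 0 < c) (hsum : k + 2 * μ.sum = n) :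
    ∃ s : Fin n ≃ ZMod n, s 0 = 0 ∧
      fullCycleType (ppRI (0 : ZMod n) s) = k ::ₘ (μ + μ) := by
  obtain ⟨m, A, B, hA, hB, hA', hB', hAB⟩ := exists_fixedPointFree_involutions_mul μ hμ
  have : NeZero k := ⟨by omega⟩
  have : Fact (1 < k) := ⟨by omega⟩
  set P : Perm (ZMod k ⊕ Fin m) := Perm.sumCongr (Equiv.subLeft 0) A with hP
  set Q : Perm (ZMod k ⊕ Fin m) := Perm.sumCongr (Equiv.subLeft (-1)) B with hQ
  have hP2 : P ^ 2 = 1 := by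
    rw [pow_two, hP, sumCongr_mul, ← pow_two, ← pow_two, subLeft_sq, hA, sumCongr_one]
  have hQ2 : Q ^ 2 = 1 := by
    rw [pow_two, hQ, sumCongr_mul, ← pow_two, ← pow_two, subLeft_sq, hB, sumCongr_one]
  have hPfix : (Finset.univ.filter fun x => P x = x).card = 1 := by
    rw [hP, card_fixed_sumCongr, card_fixed_subLeft hk]
    simp [hA']
  have hQfix : (Finset.univ.filter fun x => Q x = x).card = 1 := by
    rw [hQ, card_fixed_sumCongr, card_fixed_subLeft hk]
    simp [hB']
  have hPQ : fullCycleType (P * Q) = k ::ₘ (μ + μ) := by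
    have : (Equiv.subLeft 0 * Equiv.subLeft (-1) : Perm (ZMod k)) = Equiv.addRight 1 := by
      ext x
      simp
    rw [hP, hQ, sumCongr_mul, fullCycleType_sumCongr, hAB, this, fullCycleType_addRight_one,
      Multiset.singleton_add]
  have hcard : Fintype.card (ZMod k ⊕ Fin m) = n := by
    rw [← sum_fullCycleType (P * Q), hPQ, ← hsum]
    simp
    ring
  obtain ⟨e, he⟩ := exists_equiv_conj_of_involutive hP2 (subLeft_sq (0 : ZMod n))
    (by rw [hPfix, card_fixed_subLeft hn]) (by rw [hcard, ZMod.card])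
  obtain ⟨f, hf, hf0⟩ := exists_equiv_conj_of_involutive_apply_eq
    (A := (Fin.revPerm : Perm (Fin n))) (B := Q) (a := 0) (b := Sum.inl 0)
    (by ext; simp [pow_two]) hQ2 (by rw [hQfix, card_fixed_revPerm hn])
    (by rw [hcard, Fintype.card_fin])
    (by simp [Fin.ext_iff, Fin.val_rev]; omega) (by simp [hQ])
  refine ⟨f.trans e, ?_, ?_⟩
  · have h := he (Sum.inl 0)
    have hfix := card_fixed_subLeft hn (0 : ZMod n)
    rw [Finset.card_eq_one] at hfix
    obtain ⟨z, hz⟩ := hfix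
    simp only [Finset.ext_iff, Finset.mem_filter, Finset.mem_univ, true_and,
      Finset.mem_singleton] at hz
    have h1 : e (Sum.inl 0) = z := (hz _).1 (by rw [← h]; simp [hP])
    have h2 : 0 = z := (hz _).1 (by simp)
    simp [hf0, h1, ← h2]
  · have hpp : ppRI (0 : ZMod n) (f.trans e) = e.permCongr (P * Q) := by
      ext x
      have h := hf (f.symm (e.symm x))
      simp only [Equiv.apply_symm_apply] at h
      simp [ppRI, he, ← h]
    rw [hpp, fullCycleType_permCongr, hPQ]
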